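/- Let (C,D) be a Cartan inclusion with faithful conditional expectation E : C → D. Let D₀ ⊆ D be a unital C*-subalgebra (containing the unit of C) such that (D,D₀) is an essential inclusion, and let M ⊆ N(C,D₀) be a *-monoid (containing 1, closed under products and adjoints) such that D₀ is contained in the closed linear span of M. Put C₀ := the closed linear span of M, D₁ := the C*-subalgebra of C generated by E(C₀), C₁ := the C*-subalgebra of C generated by C₀ ∪ D₁, and let α : C₀ → C₁ be the inclusion map. Then (C₀,D₀) is a regular inclusion and (C₁,D₁,α) is a Cartan envelope for (C₀,D₀). -/

import Mathlib

open scoped ComplexOrder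
open WeakDual
set_option linter.unusedSectionVars false

namespace RegularInclusion

variable {A : Type*} [NormedRing A] [StarRing A] [CStarRing A] [CompleteSpace A]
  [NormedAlgebra ℂ A] [StarModule ℂ A]

/-- The set of normalizers of the subalgebra `D` in `A`:
`N(A,D) = {v | v* D v ⊆ D and v D v* ⊆ D}`. -/
def normSet (D : StarSubalgebra ℂ A) : Set A :=
  {v | (∀ d ∈ D, star v * d * v ∈ D) ∧ (∀ d ∈ D, v * d * star v ∈ D)}

lemma normSet.star_mul_self_mem {D : StarSubalgebra ℂ A} {v : A} (hv : v ∈ normSet D) :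
    star v * v ∈ D := by simpa using hv.1 1 D.one_mem

lemma normSet.mul_star_self_mem {D : StarSubalgebra ℂ A} {v : A} (hv : v ∈ normSet D) :
    v * star v ∈ D := by simpa using hv.2 1 D.one_mem

/-- `D` is abelian. -/
def IsAbelian (D : StarSubalgebra ℂ A) : Prop := ∀ x ∈ D, ∀ y ∈ D, x * y = y * x

/-- `(A, D)` is an inclusion: `D` is an abelian closed unital `C*`-subalgebra of `A`. -/
def IsInclusion (D : StarSubalgebra ℂ A) : Prop := IsAbelian D ∧ IsClosed (D : Set A)

/-- `(A, D)` is a regular inclusion: an inclusion for which the closed linear span of the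
normalizers is all of `A`. -/
def IsRegularIncl (D : StarSubalgebra ℂ A) : Prop :=
  IsInclusion D ∧ closure (Submodule.span ℂ (normSet D) : Set A) = Set.univ

/-- `D` is a MASA in `A`: `D` is abelian and contains every element commuting with it. -/
def IsMasa (D : StarSubalgebra ℂ A) : Prop :=
  IsAbelian D ∧ ∀ x : A, (∀ d ∈ D, x * d = d * x) → x ∈ D

/-- The relative commutant `D^c` of `D` in `A`. -/
def relComm (D : StarSubalgebra ℂ A) : StarSubalgebra ℂ A :=
  { Subalgebra.centralizer ℂ (D : Set A) with
    star_mem' := by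
      intro x hx d hd
      have h := congrArg star (hx (star d) (star_mem hd))
      simpa [star_mul] using h.symm }

lemma mem_relComm {D : StarSubalgebra ℂ A} {x : A} :
    x ∈ relComm D ↔ ∀ d ∈ D, d * x = x * d := Iff.rfl

/-- `E : A → A` is a conditional expectation onto `D`. -/
structure IsCondExp [PartialOrder A] [StarOrderedRing A] (D : StarSubalgebra ℂ A)
    (E : A →ₗ[ℂ] A) : Prop where
  mem : ∀ x : A, E x ∈ D
  idOn : ∀ d ∈ D, E d = d
  pos : ∀ x : A, 0 ≤ x → 0 ≤ E x
  bimod : ∀ d ∈ D, ∀ d' ∈ D, ∀ x : A, E (d * x * d') = d * E x * d'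

/-- A linear map is faithful if `E (x* x) = 0` implies `x = 0`. -/
def Faithful (E : A →ₗ[ℂ] A) : Prop := ∀ x : A, E (star x * x) = 0 → x = 0

/-- `(A,D)` is a Cartan inclusion: a regular MASA inclusion admitting a faithful conditional
expectation onto `D`. -/
def IsCartanIncl [PartialOrder A] [StarOrderedRing A] (D : StarSubalgebra ℂ A) : Prop :=
  IsRegularIncl D ∧ IsMasa D ∧ ∃ E : A →ₗ[ℂ] A, IsCondExp D E ∧ Faithful E

/-- The fixed-point set of the partial homeomorphism `β_v` of the character space of `D`:
those characters `σ` with `σ(v*v) > 0` and `σ(v* h v) = σ(h)·σ(v*v)` for all `h ∈ D`. -/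
def fixBeta (D : StarSubalgebra ℂ A) {v : A} (hv : v ∈ normSet D) :
    Set (characterSpace ℂ ↥D) :=
  {σ | 0 < σ (⟨star v * v, normSet.star_mul_self_mem hv⟩ : D) ∧
    ∀ h : D, σ (⟨star v * (h : A) * v, hv.1 (h : A) h.2⟩ : D)
      = σ h * σ (⟨star v * v, normSet.star_mul_self_mem hv⟩ : D)}

/-- A subset `S` of a topological algebra `B` is essential in `B` if the only closed two-sided
ideal of `B` meeting `S` trivially is the zero ideal. -/
def EssentialInSet (B : Type*) [NonUnitalNonAssocRing B] [TopologicalSpace B]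
    (S : Set B) : Prop :=
  ∀ J : TwoSidedIdeal B, IsClosed (J : Set B) → (J : Set B) ∩ S = {0} → J = ⊥

section Two
variable {B : Type*} [NormedRing B] [StarRing B] [CStarRing B] [CompleteSpace B]
  [NormedAlgebra ℂ B] [StarModule ℂ B]

/-- A `*`-homomorphism between inclusions is regular if it maps `D` into `D₁` and
normalizers to normalizers. -/
def IsRegularHom (D : StarSubalgebra ℂ A) (D₁ : StarSubalgebra ℂ B) (α : A →⋆ₐ[ℂ] B) : Prop :=
  (∀ d ∈ D, α d ∈ D₁) ∧ (∀ v ∈ normSet D, α v ∈ normSet D₁)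

/-- `(B, D₁, α)` is a package for the regular inclusion `(A, D)`, witnessed by the faithful
conditional expectation `E₁`: `(B,D₁)` is a regular inclusion, `α` is an injective regular
`*`-homomorphism, `B` is generated as a `C*`-algebra by `α(A) ∪ E₁(α(A))` and `D₁` is
generated by `E₁(α(A))`. -/
def IsPackage [PartialOrder B] [StarOrderedRing B] (D : StarSubalgebra ℂ A)
    (D₁ : StarSubalgebra ℂ B) (α : A →⋆ₐ[ℂ] B) (E₁ : B →ₗ[ℂ] B) : Prop :=
  IsRegularIncl D₁ ∧ Function.Injective α ∧ IsRegularHom D D₁ α ∧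
    IsCondExp D₁ E₁ ∧ Faithful E₁ ∧
    (StarAlgebra.adjoin ℂ (Set.range ⇑α ∪ ⇑E₁ '' Set.range ⇑α)).topologicalClosure = ⊤ ∧
    (StarAlgebra.adjoin ℂ (⇑E₁ '' Set.range ⇑α)).topologicalClosure = D₁

/-- `(D₁, α|_D)` is an essential extension of `D`. -/
def EssentialExtIn (D : StarSubalgebra ℂ A) (D₁ : StarSubalgebra ℂ B) (α : A →⋆ₐ[ℂ] B) : Prop :=
  EssentialInSet ↥D₁ {x : ↥D₁ | ∃ d ∈ D, α d = (x : B)}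

/-- `(B, D₁, α)` is a Cartan envelope of `(A, D)`, witnessed by the faithful conditional
expectation `E₁`: a package for which `(B,D₁)` is moreover a Cartan inclusion (i.e. `D₁` is
a MASA in `B`) and `(D₁, α|_D)` is an essential extension of `D`. -/
def IsCartanEnvelope [PartialOrder B] [StarOrderedRing B] (D : StarSubalgebra ℂ A)
    (D₁ : StarSubalgebra ℂ B) (α : A →⋆ₐ[ℂ] B) (E₁ : B →ₗ[ℂ] B) : Prop :=
  IsPackage D D₁ α E₁ ∧ IsMasa D₁ ∧ EssentialExtIn D D₁ α

end Two

/-- The set of normalizers of `Dα` relative to the subalgebra `Cα`. -/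
def normSetRel (Cα Dα : StarSubalgebra ℂ A) : Set A :=
  {v | v ∈ Cα ∧ (∀ d ∈ Dα, star v * d * v ∈ Dα) ∧ (∀ d ∈ Dα, v * d * star v ∈ Dα)}

/-- `φ` is an eigenfunctional for `(A,D)` with range character `r` and source character `s`. -/
def IsEigen (D : StarSubalgebra ℂ A) (φ : A →L[ℂ] ℂ) (r s : ↥D →ₐ[ℂ] ℂ) : Prop :=
  φ ≠ 0 ∧ ∀ (d₁ d₂ : D) (x : A), φ ((d₁ : A) * x * (d₂ : A)) = r d₁ * φ x * s d₂

/-- `f` is a state on `A`. -/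
def IsState (f : A →ₗ[ℂ] ℂ) : Prop := f 1 = 1 ∧ ∀ x : A, 0 ≤ f (star x * x)

/-- `f ∈ Mod(A,D)`: a state whose restriction to `D` is multiplicative (hence a character). -/
def InMod (D : StarSubalgebra ℂ A) (f : A →ₗ[ℂ] ℂ) : Prop :=
  IsState f ∧ ∀ d₁ d₂ : D, f ((d₁ : A) * (d₂ : A)) = f (d₁ : A) * f (d₂ : A)

/-- `f` is a compatible state: a state with `|f(v)|² ∈ {0, f(v*v)}` for every normalizer `v`. -/
def IsCompatState (D : StarSubalgebra ℂ A) (f : A →ₗ[ℂ] ℂ) : Prop :=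
  IsState f ∧ ∀ v ∈ normSet D, f v = 0 ∨ (Complex.normSq (f v) : ℂ) = f (star v * v)

/-- `φ` is a compatible eigenfunctional: `|φ(v)|² ∈ {0, s(φ)(v*v)}` for every normalizer `v`. -/
def IsCompatEigen (D : StarSubalgebra ℂ A) (φ : A →L[ℂ] ℂ) (r s : ↥D →ₐ[ℂ] ℂ) : Prop :=
  IsEigen D φ r s ∧ ∀ v, ∀ hv : v ∈ normSet D,
    φ v = 0 ∨ (Complex.normSq (φ v) : ℂ)
      = s (⟨star v * v, normSet.star_mul_self_mem hv⟩ : D)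

/-- The eigenfunctional `[v,f] : x ↦ f(v* x) / f(v* v)^{1/2}`. -/
noncomputable def evf (f : A →ₗ[ℂ] ℂ) (v : A) (x : A) : ℂ :=
  f (star v * x) / (Real.sqrt (f (star v * v)).re : ℂ)

/-- A bundled unital `C*`-algebra (with its canonical partial order). -/
structure CSA where
  carrier : Type
  [nr : NormedRing carrier]
  [sr : StarRing carrier]
  [cs : CStarRing carrier]
  [cp : CompleteSpace carrier]
  [na : NormedAlgebra ℂ carrier]
  [sm : StarModule ℂ carrier]
  [po : PartialOrder carrier]
  [sor : StarOrderedRing carrier]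

attribute [instance] CSA.nr CSA.sr CSA.cs CSA.cp CSA.na CSA.sm CSA.po CSA.sor

end RegularInclusion

namespace RegularInclusion

variable {A : Type*} [NormedRing A] [StarRing A] [CStarRing A] [CompleteSpace A]
  [NormedAlgebra ℂ A] [StarModule ℂ A]

/-- The unbundled assumptions on `A` assemble into a bundled `C*`-algebra structure. -/
@[reducible] def toCStarAlgebra (A : Type*) [NormedRing A] [StarRing A] [CStarRing A]
    [CompleteSpace A] [NormedAlgebra ℂ A] [StarModule ℂ A] : CStarAlgebra A := {}

lemma mul_one_sub_pow_le {u : ℝ} (h0 : 0 ≤ u) (h1 : u ≤ 1) (m : ℕ) :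
    u * (1 - u) ^ m ≤ 1 / (m + 1) := by
  have hb : 1 + (m : ℝ) * u ≤ (1 + u) ^ m := one_add_mul_le_pow (by linarith) m
  have hp : (1 - u) ^ m * (1 + u) ^ m ≤ 1 := by
    rw [← mul_pow]
    exact pow_le_one₀ (by nlinarith) (by nlinarith)
  have hq : 0 ≤ (1 - u) ^ m := pow_nonneg (by linarith) m
  have h2 : (1 - u) ^ m * (1 + m * u) ≤ 1 := (mul_le_mul_of_nonneg_left hb hq).trans hp
  have h3 : (1 - u) ^ m ≤ 1 := pow_le_one₀ (by linarith) (by linarith)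
  rw [le_div_iff₀ (by positivity)]
  nlinarith [mul_le_mul_of_nonneg_left h1 hq]

/-- The powers of `1 - l a a*` are contractions annihilating `a` asymptotically. -/
lemma exists_pow_mul_tendsto_zero (a : A) : ∃ l : ℝ,
    (∀ n : ℕ, ‖(1 - l • (a * star a)) ^ n‖ ≤ 1) ∧
    Filter.Tendsto (fun n : ℕ ↦ (1 - l • (a * star a)) ^ n * a) Filter.atTop (nhds 0) := by
  let _ := toCStarAlgebra A
  let _ := CStarAlgebra.spectralOrder A
  have _ := CStarAlgebra.spectralOrderedRing A
  set t : A := a * star a with ht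
  have ht0 : 0 ≤ t := mul_star_self_nonneg a
  have hts : IsSelfAdjoint t := .of_nonneg ht0
  have hsp : ∀ s ∈ spectrum ℝ t, 0 ≤ s ∧ s ≤ ‖t‖ := fun s hs ↦
    ⟨spectrum_nonneg_of_nonneg ht0 hs, (le_abs_self s).trans
      (by simpa [cfc_id' ℝ t] using norm_apply_le_norm_cfc (fun x : ℝ ↦ x) t hs)⟩
  obtain ⟨l, hl0, hls⟩ : ∃ l : ℝ, 0 < l ∧ ∀ s ∈ spectrum ℝ t, 0 ≤ l * s ∧ l * s ≤ 1 := by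
    refine ⟨(‖t‖ + 1)⁻¹, by positivity, fun s hs ↦ ?_⟩
    obtain ⟨h0, h1⟩ := hsp s hs
    refine ⟨by positivity, ?_⟩
    rw [inv_mul_le_iff₀ (by positivity)]
    linarith
  have hc : ∀ n : ℕ, (1 - l • t) ^ n = cfc (fun s : ℝ ↦ (1 - l * s) ^ n) t := fun n ↦ by
    rw [cfc_pow (fun s : ℝ ↦ 1 - l * s) n t, cfc_sub (fun _ : ℝ ↦ (1 : ℝ)) (fun s : ℝ ↦ l * s) t,
      cfc_const_one ℝ t, cfc_const_mul_id l t]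
  refine ⟨l, fun n ↦ ?_, ?_⟩
  · rw [hc]
    refine norm_cfc_le zero_le_one fun s hs ↦ ?_
    obtain ⟨h0, h1⟩ := hls s hs
    rw [norm_pow, Real.norm_of_nonneg (by linarith)]
    exact pow_le_one₀ (by linarith) (by linarith)
  · have hb : ∀ n : ℕ, ‖(1 - l • t) ^ n * a‖ ^ 2 ≤ l⁻¹ * (1 / ((n : ℝ) + 1)) := fun n ↦ by
      have hsa : star ((1 - l • t) ^ n) = (1 - l • t) ^ n := by
        simp [hts.star_eq]
      have h1 : (1 - l • t) ^ n * a * star ((1 - l • t) ^ n * a)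
          = cfc (fun s : ℝ ↦ (1 - l * s) ^ n * s * (1 - l * s) ^ n) t := by
        rw [cfc_mul (fun s : ℝ ↦ (1 - l * s) ^ n * s) (fun s : ℝ ↦ (1 - l * s) ^ n) t
            (by fun_prop) (by fun_prop),
          cfc_mul (fun s : ℝ ↦ (1 - l * s) ^ n) (fun s : ℝ ↦ s) t (by fun_prop) (by fun_prop),
          ← hc, cfc_id' ℝ t, star_mul, hsa, ht]
        simp only [mul_assoc]
      rw [sq, ← CStarRing.norm_self_mul_star, h1]
      refine norm_cfc_le (by positivity) fun s hs ↦ ?_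
      obtain ⟨h0, h1⟩ := hls s hs
      have h2 := mul_one_sub_pow_le h0 h1 n
      have h3 : (1 - l * s) ^ n ≤ 1 := pow_le_one₀ (by linarith) (by linarith)
      have h4 : 0 ≤ (1 - l * s) ^ n := pow_nonneg (by linarith) n
      have h5 := (hsp s hs).1
      rw [Real.norm_of_nonneg (by positivity), le_inv_mul_iff₀ hl0]
      calc l * ((1 - l * s) ^ n * s * (1 - l * s) ^ n)
          = (l * s * (1 - l * s) ^ n) * (1 - l * s) ^ n := by ring
        _ ≤ (l * s * (1 - l * s) ^ n) * 1 := by gcongr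
        _ ≤ _ := by simpa using h2
    have h0 : Filter.Tendsto (fun n : ℕ ↦ ‖(1 - l • t) ^ n * a‖ ^ 2) Filter.atTop (nhds 0) := by
      refine squeeze_zero (fun n ↦ by positivity) hb ?_
      simpa using tendsto_one_div_add_atTop_nhds_zero_nat.const_mul l⁻¹
    rw [tendsto_zero_iff_norm_tendsto_zero]
    simpa using h0.sqrt

/-- Any `a` is a limit of elements `c n * (a a*) * a` with `c n` in a given `*`-subalgebra
containing `a a*`. -/
lemma exists_tendsto_mul_self {S : StarSubalgebra ℂ A} {a : A} (ha : a * star a ∈ S) :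
    ∃ c : ℕ → A, (∀ n, c n ∈ S) ∧
      Filter.Tendsto (fun n ↦ c n * (a * star a) * a) Filter.atTop (nhds a) := by
  obtain ⟨l, -, hl⟩ := exists_pow_mul_tendsto_zero a
  set t := a * star a
  have hlt : l • t ∈ S := by
    rw [← Complex.coe_smul]
    exact S.smul_mem ha _
  refine ⟨fun n ↦ l • ∑ i ∈ Finset.range n, (1 - l • t) ^ i, fun n ↦ ?_, ?_⟩
  · rw [← Complex.coe_smul]
    exact S.smul_mem (sum_mem fun i _ ↦ pow_mem (sub_mem S.one_mem hlt) i) _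
  · have h : (fun n : ℕ ↦ (l • ∑ i ∈ Finset.range n, (1 - l • t) ^ i) * t * a)
        = fun n ↦ a - (1 - l • t) ^ n * a := by
      funext n
      have := geom_sum_mul (1 - l • t) n
      rw [sub_sub_cancel_left, mul_neg, mul_smul_comm, ← smul_mul_assoc, neg_eq_iff_eq_neg,
        neg_sub] at this
      rw [this, sub_mul, one_mul]
    rw [h]
    simpa using tendsto_const_nhds.sub hl

lemma star_mul_mul_eq_zero {D : StarSubalgebra ℂ A} (hD : IsAbelian D) {v h x : A}
    (hv : v * star v ∈ D) (hh : h ∈ D) (hx : star v * x = 0) : star v * (h * x) = 0 := by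
  rw [← CStarRing.star_mul_self_eq_zero_iff]
  calc star (star v * (h * x)) * (star v * (h * x))
      = star x * star h * (v * star v * h) * x := by simp only [star_mul, star_star, mul_assoc]
    _ = star x * star h * h * v * (star v * x) := by
        rw [hD _ hv _ hh]; simp only [mul_assoc]
    _ = 0 := by rw [hx, mul_zero]

lemma eq_zero_of_mul_self {D : StarSubalgebra ℂ A} (hD : IsAbelian D) {x : A}
    (hx : x ∈ D) (h : x * x = 0) : x = 0 := by
  have h1 : star x * x = 0 := by
    rw [← CStarRing.star_mul_self_eq_zero_iff]
    calc star (star x * x) * (star x * x) = star x * (x * star x) * x := by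
          simp only [star_mul, star_star, mul_assoc]
      _ = star x * star x * (x * x) := by rw [hD _ hx _ (star_mem hx)]; simp only [mul_assoc]
      _ = 0 := by rw [h, mul_zero]
  rwa [CStarRing.star_mul_self_eq_zero_iff] at h1

lemma normSet.star_mem {D : StarSubalgebra ℂ A} {v : A} (hv : v ∈ normSet D) :
    star v ∈ normSet D :=
  ⟨fun d hd ↦ by simpa using hv.2 d hd, fun d hd ↦ by simpa using hv.1 d hd⟩

lemma normSet.mul_mem {D : StarSubalgebra ℂ A} {v w : A} (hv : v ∈ normSet D)
    (hw : w ∈ normSet D) : v * w ∈ normSet D :=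
  ⟨fun d hd ↦ by simpa [mul_assoc] using hw.1 _ (hv.1 d hd),
    fun d hd ↦ by simpa [mul_assoc] using hv.2 _ (hw.2 d hd)⟩

lemma normSet.of_mem {D : StarSubalgebra ℂ A} {v : A} (hv : v ∈ D) : v ∈ normSet D :=
  ⟨fun _ hd ↦ MulMemClass.mul_mem (MulMemClass.mul_mem (StarMemClass.star_mem hv) hd) hv,
    fun _ hd ↦ MulMemClass.mul_mem (MulMemClass.mul_mem hv hd) (StarMemClass.star_mem hv)⟩

/-- Characters separate the points of a closed abelian `*`-subalgebra. -/
lemma exists_algHom_apply_ne_zero {D : StarSubalgebra ℂ A} (hD : IsAbelian D)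
    (hcl : IsClosed (D : Set A)) {x : D} (hx : x ≠ 0) : ∃ σ : D →ₐ[ℂ] ℂ, σ x ≠ 0 := by
  let _ := toCStarAlgebra A
  let _ : CommCStarAlgebra D :=
    { StarSubalgebra.cstarAlgebra D (h_closed := hcl) with
      mul_comm := fun a b ↦ Subtype.ext (hD _ a.2 _ b.2) }
  have h : gelfandTransform ℂ D x ≠ 0 := fun h ↦
    hx ((gelfandTransform_isometry D).injective (by rw [h, map_zero]))
  obtain ⟨σ, hσ⟩ : ∃ σ, gelfandTransform ℂ D x σ ≠ 0 := by
    by_contra! h'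
    exact h (ContinuousMap.ext h')
  exact ⟨CharacterSpace.toAlgHom σ, hσ⟩

lemma algHom_apply_mem_spectrum {D : StarSubalgebra ℂ A} (hcl : IsClosed (D : Set A))
    (σ : D →ₐ[ℂ] ℂ) (x : D) : σ x ∈ spectrum ℂ (x : A) := by
  let _ := toCStarAlgebra A
  have := hcl
  rw [← StarSubalgebra.spectrum_eq D]
  exact AlgHom.apply_mem_spectrum σ x

lemma algHom_apply_im {D : StarSubalgebra ℂ A} (hcl : IsClosed (D : Set A))
    (σ : D →ₐ[ℂ] ℂ) {x : D} (hx : IsSelfAdjoint (x : A)) : (σ x).im = 0 := by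
  let _ := toCStarAlgebra A
  exact hx.im_eq_zero_of_mem_spectrum (algHom_apply_mem_spectrum hcl σ x)

lemma algHom_apply_re_nonneg [PartialOrder A] [StarOrderedRing A] {D : StarSubalgebra ℂ A}
    (hcl : IsClosed (D : Set A)) (σ : D →ₐ[ℂ] ℂ) {x : D} (hx : 0 ≤ (x : A)) :
    0 ≤ (σ x).re := by
  let _ := toCStarAlgebra A
  exact (Complex.nonneg_iff.1
    (spectrum_nonneg_of_nonneg hx (algHom_apply_mem_spectrum hcl σ x))).1

/-- A normalizer `w` of `D` commuting with an essential subalgebra of `D` implements the identity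
on the level of supports. -/
lemma mul_conj_mul_eq_zero {D D₀ : StarSubalgebra ℂ A} (hD : IsAbelian D)
    (hess : EssentialInSet ↥D {x : ↥D | (x : A) ∈ D₀}) {w : A} (hw : w ∈ normSet D)
    (hc : ∀ h ∈ D₀, w * h = h * w) {g k : A} (hg : g ∈ D) (hk : k ∈ D) (hgk : g * k = 0) :
    g * (star w * k * w) * (star w * w) = 0 := by
  have hz := normSet.star_mul_self_mem hw
  have hwk := hw.1 k hk
  set z := star w * w with hzdef
  set e := star w * k * w with hedef
  set f := g * e * z with hf
  have hge : g * e ∈ D := mul_mem hg hwk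
  have hfD : f ∈ D := mul_mem hge hz
  have hcs : ∀ h ∈ D₀, star w * h = h * star w := fun h hh ↦ by
    simpa using congrArg star (hc _ (star_mem hh)).symm
  have hfw : f * (star w * f * w) = 0 := by
    have h1 : e * (star w * f * w) = 0 := by
      calc e * (star w * f * w) = star w * (k * ((w * star w) * g)) * (e * z * w) := by
            simp only [hedef, hf, mul_assoc]
        _ = 0 := by
            rw [hD _ (normSet.mul_star_self_mem hw) _ hg, ← mul_assoc k, hD _ hk _ hg, hgk]
            simp
    calc f * (star w * f * w) = g * (z * e) * (star w * f * w) := by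
          rw [← hD _ hwk _ hz, ← mul_assoc g]
      _ = g * z * (e * (star w * f * w)) := by simp only [mul_assoc]
      _ = 0 := by rw [h1, mul_zero]
  have hb : w * f * star w ∈ D := hw.2 f hfD
  have hbf : w * f * star w * f = 0 := by
    refine eq_zero_of_mul_self hD (mul_mem hb hfD) ?_
    calc w * f * star w * f * (w * f * star w * f)
        = w * (f * (star w * f * w)) * (f * star w * f) := by simp only [mul_assoc]
      _ = 0 := by rw [hfw]; simp
  let J : TwoSidedIdeal D := TwoSidedIdeal.mk' {x : D | ∀ b ∈ D, b * f = 0 → (x : A) * b = 0}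
    (by simp) (fun hx hy b hb h ↦ by simp [add_mul, hx b hb h, hy b hb h])
    (fun hx b hb h ↦ by simp [hx b hb h])
    (fun {x y} hy b hb h ↦ by simp [mul_assoc, hy b hb h])
    (fun {x y} hx b hb h ↦ by
      rw [MulMemClass.coe_mul, mul_assoc, hD _ y.2 _ hb, ← mul_assoc, hx b hb h, zero_mul])
  have hmemJ : ∀ x : D, x ∈ J ↔ ∀ b ∈ D, b * f = 0 → (x : A) * b = 0 := fun x ↦
    TwoSidedIdeal.mem_mk' _ _ _ _ _ _ x
  have hJcl : IsClosed (J : Set D) := by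
    have : (J : Set D) = ⋂ b ∈ D, ⋂ _ : b * f = 0, {x : D | (x : A) * b = 0} := by
      ext x
      simpa using hmemJ x
    rw [this]
    refine isClosed_biInter fun b _ ↦ isClosed_iInter fun _ ↦ ?_
    exact isClosed_eq (by fun_prop) continuous_const
  have hJ : J = ⊥ := by
    refine hess J hJcl (Set.eq_singleton_iff_unique_mem.2 ⟨⟨J.zero_mem, D₀.zero_mem⟩, ?_⟩)
    rintro ⟨h, hhD⟩ ⟨hhJ, hh0⟩
    replace hhJ : ∀ b ∈ D, b * f = 0 → h * b = 0 := (hmemJ ⟨h, hhD⟩).1 hhJ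
    replace hh0 : h ∈ D₀ := hh0
    have h1 : h * f * (z * z) = 0 := by
      calc h * f * (z * z) = h * (z * f) * z := by rw [hD _ hz _ hfD]; simp only [mul_assoc]
        _ = (h * star w) * (w * f * star w) * w := by simp only [hzdef, mul_assoc]
        _ = star w * (h * (w * f * star w)) * w := by rw [← hcs h hh0]; simp only [mul_assoc]
        _ = 0 := by rw [hhJ _ hb hbf]; simp
    have h2 : h * f * z = 0 := by
      refine eq_zero_of_mul_self hD (mul_mem (mul_mem hhD hfD) hz) ?_
      calc h * f * z * (h * f * z) = h * f * z * (z * (h * f)) :=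
            congrArg (h * f * z * ·) (hD _ (mul_mem hhD hfD) _ hz)
        _ = h * f * (z * z) * (h * f) := by simp only [mul_assoc]
        _ = 0 := by rw [h1, zero_mul]
    have h3 : h * f = 0 := by
      refine eq_zero_of_mul_self hD (mul_mem hhD hfD) ?_
      calc h * f * (h * f) = h * f * ((h * (g * e)) * z) := by simp only [hf, mul_assoc]
        _ = h * f * z * (h * (g * e)) := by
            rw [hD (h * (g * e)) (mul_mem hhD hge) z hz]; simp only [mul_assoc]
        _ = 0 := by rw [h2, zero_mul]
    have h4 : star h * f = 0 := by
      refine eq_zero_of_mul_self hD (mul_mem (star_mem hhD) hfD) ?_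
      calc star h * f * (star h * f) = star h * ((f * star h) * f) := by simp only [mul_assoc]
        _ = star h * (star h * (f * f)) := by
            rw [hD _ hfD _ (star_mem hhD)]; simp only [mul_assoc]
        _ = 0 := ?_
      have h5 : star h * (star h * (f * f)) * (star (star h * (star h * (f * f)))) = 0 := by
        have h6 : (f * f) * star (star h * (star h * (f * f))) = f * f * star (f * f) * h * h := by
          simp only [star_mul, star_star, mul_assoc]
        have h7 : (f * f * star (f * f)) * h = 0 := by
          rw [hD _ (mul_mem (mul_mem hfD hfD) (star_mem (mul_mem hfD hfD))) _ hhD, ← mul_assoc,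
            ← mul_assoc, h3]
          simp
        rw [mul_assoc, mul_assoc, h6, h7]
        simp
      rwa [CStarRing.mul_star_self_eq_zero_iff] at h5
    exact Subtype.ext (CStarRing.mul_star_self_eq_zero_iff h |>.1 (hhJ _ (star_mem hhD) h4))
  have hfJ : (⟨f, hfD⟩ : D) ∈ J := (hmemJ _).2 fun b hb h ↦ by
    rw [hD _ hfD _ hb]
    exact h
  rw [hJ, TwoSidedIdeal.mem_bot] at hfJ
  exact congrArg Subtype.val hfJ

/-- A normalizer of `D` commuting with an essential subalgebra of `D` commutes with `D`. -/
lemma commute_of_commute_essential {D D₀ : StarSubalgebra ℂ A} (hD : IsAbelian D)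
    (hcl : IsClosed (D : Set A)) (hess : EssentialInSet ↥D {x : ↥D | (x : A) ∈ D₀}) {w : A}
    (hw : w ∈ normSet D) (hc : ∀ h ∈ D₀, w * h = h * w) : ∀ d ∈ D, w * d = d * w := by
  let _ := toCStarAlgebra A
  let _ := CStarAlgebra.spectralOrder A
  have _ := CStarAlgebra.spectralOrderedRing A
  have hz := normSet.star_mul_self_mem hw
  have key : ∀ d ∈ D, IsSelfAdjoint d → star w * d * w = star w * w * d := by
    intro d hd hds
    by_contra hne
    obtain ⟨σ, hσ⟩ := exists_algHom_apply_ne_zero hD hcl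
      (x := ⟨star w * d * w, hw.1 d hd⟩ - ⟨star w * w, hz⟩ * ⟨d, hd⟩)
      (fun h ↦ hne (sub_eq_zero.1 (congrArg Subtype.val h)))
    let z : D := ⟨star w * w, hz⟩
    let W : D → D := fun x ↦ ⟨star w * x * w, hw.1 x x.2⟩
    have hWsub : ∀ x y, W (x - y) = W x - W y := fun x y ↦ Subtype.ext (by
      simp [W, mul_sub, sub_mul])
    set d' : D := ⟨d, hd⟩
    replace hσ : σ (W d') - σ z * σ d' ≠ 0 := by simpa using hσ
    have hz0 : 0 ≤ (σ z).re := algHom_apply_re_nonneg hcl σ (star_mul_self_nonneg w)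
    have hzi : (σ z).im = 0 := algHom_apply_im hcl σ (.star_mul_self w)
    have hdi : (σ d').im = 0 := algHom_apply_im hcl σ hds
    have hWi : (σ (W d')).im = 0 := algHom_apply_im hcl σ (hds.conjugate' w)
    have hWz : (σ (W d')) ^ 2 = σ z * σ (W (d' * d')) := by
      rw [← map_pow, ← map_mul]
      congr 1
      apply Subtype.ext
      change (star w * d * w) ^ 2 = (star w * w) * (star w * (d * d) * w)
      rw [sq]
      calc star w * d * w * (star w * d * w) = star w * (d * (w * star w)) * d * w := by
            simp only [mul_assoc]
        _ = _ := by rw [hD _ hd _ (normSet.mul_star_self_mem hw)]; simp only [mul_assoc]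
    set a := (σ z).re
    set p := (σ (W d')).re
    set q := (σ d').re
    have hza : σ z = a := Complex.ext rfl (by simpa using hzi)
    have hdq : σ d' = q := Complex.ext rfl (by simpa using hdi)
    have hWp : σ (W d') = p := Complex.ext rfl (by simpa using hWi)
    have hpq : p ≠ a * q := fun h ↦ hσ (by rw [hza, hdq, hWp, h]; push_cast; ring)
    have ha : 0 < a := by
      refine lt_of_le_of_ne hz0 fun h ↦ hσ ?_
      rw [hza, ← h] at hWz ⊢
      simpa using hWz
    obtain ⟨m, hm⟩ : ∃ m : ℝ, 2 * (m * a) = p + a * q :=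
      ⟨(p + a * q) / (2 * a), by field_simp⟩
    let g : D := ⟨cfc (fun x : ℝ ↦ max (x - m) 0) d, cfc_mem _ hd⟩
    let k : D := ⟨cfc (fun x : ℝ ↦ max (m - x) 0) d, cfc_mem _ hd⟩
    have hg0 : 0 ≤ (g : A) := cfc_nonneg fun x _ ↦ le_max_right _ _
    have hk0 : 0 ≤ (k : A) := cfc_nonneg fun x _ ↦ le_max_right _ _
    have hgk : g * k = 0 := by
      apply Subtype.ext
      change cfc (fun x : ℝ ↦ max (x - m) 0) d * cfc (fun x : ℝ ↦ max (m - x) 0) d = 0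
      rw [← cfc_mul _ _ d (by fun_prop) (by fun_prop)]
      convert cfc_const_zero ℝ d with x
      rcases le_total x m with h | h
      · simp [h]
      · simp [h]
    have hkg : k * g = 0 := (Subtype.ext (hD _ k.2 _ g.2)).trans hgk
    have hgmk : g - k = d' - algebraMap ℂ D m := by
      apply Subtype.ext
      change cfc (fun x : ℝ ↦ max (x - m) 0) d - cfc (fun x : ℝ ↦ max (m - x) 0) d
        = d - algebraMap ℝ A m
      rw [← cfc_sub _ _ d (by fun_prop) (by fun_prop), ← cfc_const m d hds]
      nth_rw 2 [← cfc_id' ℝ d]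
      rw [← cfc_sub _ _ d (by fun_prop) (by fun_prop)]
      congr 1
      funext x
      rcases le_total x m with h | h
      · simp [h]
      · simp [h]
    have h1 : (σ g).re - (σ k).re = q - m := by
      rw [← Complex.sub_re, ← map_sub, hgmk, map_sub, hdq]
      simp
    have h2 : (σ (W g)).re - (σ (W k)).re = p - m * a := by
      have hWm : W (algebraMap ℂ D m) = (m : ℂ) • z := Subtype.ext (by
        simp [W, z, Algebra.algebraMap_eq_smul_one])
      rw [← Complex.sub_re, ← map_sub, ← hWsub, hgmk, hWsub, hWm, map_sub, map_smul, hWp, hza]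
      simp
    have hdisj : ∀ x y : D, 0 ≤ (x : A) → 0 ≤ (y : A) → x * y = 0 →
        (σ x).re * (σ (W y)).re = 0 := by
      intro x y hx hy hxy
      have h3 : x * W y * z = 0 := Subtype.ext
        (mul_conj_mul_eq_zero hD hess hw hc x.2 y.2 (congrArg Subtype.val hxy))
      have h4 := congrArg σ h3
      rw [map_mul, map_mul, map_zero, hza, mul_eq_zero, or_iff_left (by simpa using ha.ne')] at h4
      have h5 := congrArg Complex.re h4
      rw [Complex.mul_re, algHom_apply_im hcl σ (IsSelfAdjoint.of_nonneg hx)] at h5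
      simpa using h5
    have hgn := algHom_apply_re_nonneg hcl σ hg0
    have hkn := algHom_apply_re_nonneg hcl σ hk0
    have hWg : 0 ≤ (σ (W g)).re :=
      algHom_apply_re_nonneg hcl σ (star_left_conjugate_nonneg hg0 w)
    have hWk : 0 ≤ (σ (W k)).re :=
      algHom_apply_re_nonneg hcl σ (star_left_conjugate_nonneg hk0 w)
    have h5 := hdisj g k hg0 hk0 hgk
    have h6 := hdisj k g hk0 hg0 hkg
    rcases lt_or_gt_of_ne hpq with h | h
    · have h7 : 0 < (σ g).re := by nlinarith
      have h8 : 0 < (σ (W k)).re := by nlinarith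
      exact (mul_pos h7 h8).ne' h5
    · have h7 : 0 < (σ k).re := by nlinarith
      have h8 : 0 < (σ (W g)).re := by nlinarith
      exact (mul_pos h7 h8).ne' h6
  have hsa : ∀ d ∈ D, IsSelfAdjoint d → w * d = d * w := by
    intro d hd hds
    have h0 : star w * (d * w - w * d) = 0 := by
      rw [mul_sub, ← mul_assoc, ← mul_assoc, key d hd hds, sub_self]
    have h1 : star (d * w - w * d) * (d * w - w * d) = 0 := by
      rw [star_sub, star_mul, star_mul, hds.star_eq, sub_mul, mul_assoc, mul_assoc,
        star_mul_mul_eq_zero hD (normSet.mul_star_self_mem hw) hd h0, h0, mul_zero, sub_zero]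
    rw [CStarRing.star_mul_self_eq_zero_iff, sub_eq_zero] at h1
    exact h1.symm
  intro d hd
  have h1 := hsa _ (add_mem hd (star_mem hd)) (IsSelfAdjoint.add_star_self d)
  have h2 := hsa (Complex.I • (d - star d)) (D.smul_mem (sub_mem hd (star_mem hd)) _) (by
    simp [IsSelfAdjoint, star_smul, ← smul_neg])
  rw [mul_smul_comm, smul_mul_assoc] at h2
  have h3 := smul_right_injective A Complex.I_ne_zero h2
  have h4 : (2 : ℂ) • (w * d) = (2 : ℂ) • (d * w) := by
    have h5 := congrArg₂ (· + ·) h1 h3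
    simp only [mul_add, add_mul, mul_sub, sub_mul] at h5
    rw [two_smul, two_smul]
    convert h5 using 1 <;> abel
  exact smul_right_injective A two_ne_zero h4

/-- Conjugation by a normalizer of `D₀` maps `D` into the relative commutant of `D₀`. -/
lemma conj_commute {D D₀ : StarSubalgebra ℂ A} (hD : IsAbelian D) (hD₀D : D₀ ≤ D) {v : A}
    (hv : v ∈ normSet D₀) {d h : A} (hd : d ∈ D) (hh : h ∈ D₀) :
    star v * d * v * h = h * (star v * d * v) := by
  have hz := normSet.star_mul_self_mem hv
  set z := star v * v with hzdef
  set P := star v * d * v with hP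
  have h1 : ∀ k ∈ D₀, P * k * z = z * k * P := fun k hk ↦ by
    calc P * k * z = star v * (d * (v * k * star v)) * v := by simp only [hP, hzdef, mul_assoc]
      _ = z * k * P := by
        rw [hD _ hd _ (hD₀D (hv.2 k hk))]; simp only [hP, hzdef, mul_assoc]
  have h2 : P * z = z * P := by simpa using h1 1 D₀.one_mem
  have h3 : (P * h - h * P) * z = 0 := by
    rw [sub_mul, h1 h hh, mul_assoc h, h2, ← mul_assoc h, hD _ (hD₀D hh) _ (hD₀D hz), sub_self]
  set X := P * h - h * P with hX
  have h4 : v * star X = 0 := by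
    rw [← CStarRing.star_mul_self_eq_zero_iff]
    calc star (v * star X) * (v * star X) = X * z * star X := by
          simp only [star_mul, star_star, hzdef, mul_assoc]
      _ = 0 := by rw [h3, zero_mul]
  have h5 : v * (h * star X) = 0 := by
    have := star_mul_mul_eq_zero (D := D₀) (v := star v) (h := h) (x := star X)
      (fun x hx y hy ↦ hD x (hD₀D hx) y (hD₀D hy)) (by simpa using hz) hh (by simpa using h4)
    simpa using this
  have h6 : X * star X = 0 := by
    calc X * star X = (P * h - h * P) * star X := rfl
      _ = star v * d * (v * (h * star X)) - h * star v * d * (v * star X) := by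
        simp only [sub_mul, hP, mul_assoc]
      _ = 0 := by rw [h5, h4]; simp
  rw [CStarRing.mul_star_self_eq_zero_iff] at h6
  exact sub_eq_zero.1 h6

/-- Essentiality passes to intermediate subalgebras. -/
lemma EssentialInSet.of_le {D D₀ D₁ : StarSubalgebra ℂ A} (hD : IsAbelian D) (h₀₁ : D₀ ≤ D₁)
    (h₁ : D₁ ≤ D) (hess : EssentialInSet ↥D {x : ↥D | (x : A) ∈ D₀}) :
    EssentialInSet ↥D₁ {x : ↥D₁ | (x : A) ∈ D₀} := by
  intro J hJcl hJ
  let s : Set D := {h | ∀ ε > (0 : ℝ), ∃ e ∈ J, ‖(1 : A) - (e : A)‖ ≤ 1 ∧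
    ‖(1 - (e : A)) * (h : A)‖ ≤ ε}
  have hmul : ∀ {x y : D}, y ∈ s → x * y ∈ s := by
    intro x y hy ε hε
    obtain ⟨e, heJ, he1, hey⟩ := hy (ε / (‖(x : A)‖ + 1)) (by positivity)
    refine ⟨e, heJ, he1, ?_⟩
    rw [MulMemClass.coe_mul, hD _ x.2 _ y.2, ← mul_assoc]
    refine (norm_mul_le _ _).trans ((mul_le_mul_of_nonneg_right hey (norm_nonneg _)).trans ?_)
    rw [div_mul_eq_mul_div, div_le_iff₀ (by positivity)]
    nlinarith [norm_nonneg (x : A)]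
  have hone : ‖(1 : A)‖ ≤ 1 := by
    obtain ⟨l, hl, -⟩ := exists_pow_mul_tendsto_zero (0 : A)
    simpa using hl 0
  let I : TwoSidedIdeal D := TwoSidedIdeal.mk' s
    (fun ε hε ↦ ⟨0, J.zero_mem, by
      simpa using hone, by simpa using hε.le⟩)
    (by
      intro x y hx hy ε hε
      obtain ⟨e, heJ, he1, hex⟩ := hx (ε / 2) (by positivity)
      obtain ⟨f, hfJ, hf1, hfy⟩ := hy (ε / 2) (by positivity)
      have hc : (1 - (e : A)) * (1 - (f : A)) = (1 - (f : A)) * (1 - (e : A)) :=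
        hD _ (sub_mem D.one_mem (h₁ e.2)) _ (sub_mem D.one_mem (h₁ f.2))
      have h1 : (1 : A) - ((e + f - e * f : D₁) : A) = (1 - (e : A)) * (1 - (f : A)) := by
        push_cast
        noncomm_ring
      refine ⟨e + f - e * f, J.sub_mem (J.add_mem heJ hfJ) (J.mul_mem_right _ _ heJ), ?_, ?_⟩
      · rw [h1]
        exact (norm_mul_le _ _).trans (mul_le_one₀ he1 (norm_nonneg _) hf1)
      · rw [h1, AddMemClass.coe_add, mul_add]
        refine (norm_add_le _ _).trans ?_
        have h2 : ‖(1 - (e : A)) * (1 - (f : A)) * x‖ ≤ 1 * (ε / 2) := by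
          rw [hc, mul_assoc]
          exact (norm_mul_le _ _).trans (mul_le_mul hf1 hex (norm_nonneg _) zero_le_one)
        have h3 : ‖(1 - (e : A)) * (1 - (f : A)) * y‖ ≤ 1 * (ε / 2) := by
          rw [mul_assoc]
          exact (norm_mul_le _ _).trans (mul_le_mul he1 hfy (norm_nonneg _) zero_le_one)
        linarith)
    (fun {x} hx ε hε ↦ by simpa using hx ε hε)
    hmul
    (fun {x y} hx ↦ by
      rw [show x * y = y * x from Subtype.ext (hD _ x.2 _ y.2)]
      exact hmul hx)
  have hmemI : ∀ x : D, x ∈ I ↔ x ∈ s := fun x ↦ TwoSidedIdeal.mem_mk' _ _ _ _ _ _ x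
  have hIs : (I : Set D) = s := Set.ext hmemI
  have hIcl : IsClosed (I : Set D) := by
    rw [hIs, ← closure_subset_iff_isClosed]
    intro x hx ε hε
    obtain ⟨y, hy, hxy⟩ := Metric.mem_closure_iff.1 hx (ε / 2) (by positivity)
    obtain ⟨e, heJ, he1, hey⟩ := hy (ε / 2) (by positivity)
    refine ⟨e, heJ, he1, ?_⟩
    have h1 : (1 - (e : A)) * (x : A) = (1 - (e : A)) * (x - y : A) + (1 - (e : A)) * y := by
      noncomm_ring
    have h2 : ‖(x - y : A)‖ ≤ ε / 2 := by
      rw [dist_eq_norm] at hxy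
      exact hxy.le
    rw [h1]
    refine (norm_add_le _ _).trans ?_
    have h3 : ‖(1 - (e : A)) * (x - y : A)‖ ≤ 1 * (ε / 2) :=
      (norm_mul_le _ _).trans (mul_le_mul he1 h2 (norm_nonneg _) zero_le_one)
    linarith
  have hJI : ∀ j ∈ J, (⟨j, h₁ j.2⟩ : D) ∈ s := by
    intro j hj ε hε
    obtain ⟨l, hl1, hl⟩ := exists_pow_mul_tendsto_zero (j : A)
    obtain ⟨n, hn⟩ := ((tendsto_zero_iff_norm_tendsto_zero.1 hl).eventually_lt_const hε).exists
    let y : D₁ := algebraMap ℂ D₁ l * (j * star j)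
    have hy : y ∈ J := J.mul_mem_left _ _ (J.mul_mem_right _ _ hj)
    have hyn : ∀ m : ℕ, 1 - (1 - y) ^ m ∈ J := by
      intro m
      induction m with
      | zero => simp
      | succ m ih =>
        rw [show 1 - (1 - y) ^ (m + 1) = (1 - (1 - y) ^ m) + (1 - y) ^ m * y by
          rw [pow_succ]; noncomm_ring]
        exact J.add_mem ih (J.mul_mem_left _ _ hy)
    have hcoe : (1 : A) - ((1 - (1 - y) ^ n : D₁) : A) = (1 - l • ((j : A) * star (j : A))) ^ n := by
      simp [y, Algebra.algebraMap_eq_smul_one]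
    refine ⟨1 - (1 - y) ^ n, hyn n, ?_, ?_⟩
    · rw [hcoe]
      exact hl1 n
    · rw [hcoe]
      exact hn.le
  have hsJ : ∀ x : D₁, (⟨x, h₁ x.2⟩ : D) ∈ s → x ∈ J := by
    intro x hx
    change x ∈ (J : Set D₁)
    rw [← hJcl.closure_eq, Metric.mem_closure_iff]
    intro ε hε
    obtain ⟨e, heJ, -, he⟩ := hx (ε / 2) (by positivity)
    refine ⟨e * x, J.mul_mem_right _ _ heJ, ?_⟩
    rw [dist_eq_norm]
    refine lt_of_le_of_lt ?_ (half_lt_self hε)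
    rwa [sub_mul, one_mul] at he
  have hI : I = ⊥ := by
    refine hess I hIcl (Set.eq_singleton_iff_unique_mem.2 ⟨⟨I.zero_mem, D₀.zero_mem⟩, ?_⟩)
    rintro ⟨h, hhD⟩ ⟨hhI, hh0⟩
    replace hh0 : h ∈ D₀ := hh0
    have h1 : (⟨h, h₀₁ hh0⟩ : D₁) ∈ (J : Set D₁) ∩ {x : D₁ | (x : A) ∈ D₀} :=
      ⟨hsJ _ ((hmemI _).1 hhI), hh0⟩
    rw [hJ] at h1
    exact Subtype.ext (congrArg (Subtype.val : D₁ → A) h1)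
  rw [eq_bot_iff]
  intro j hj
  have h1 := (hmemI _).2 (hJI j hj)
  rw [hI, TwoSidedIdeal.mem_bot] at h1
  rw [TwoSidedIdeal.mem_bot]
  exact Subtype.ext (congrArg (Subtype.val : D → A) h1)

variable [PartialOrder A] [StarOrderedRing A]

namespace IsCondExp

variable {D : StarSubalgebra ℂ A} {E : A →ₗ[ℂ] A}

lemma map_star (hE : IsCondExp D E) (x : A) : E (star x) = star (E x) := by
  let _ := toCStarAlgebra A
  exact StarHomClass.map_star (PositiveLinearMap.mk₀ E hE.pos) x

lemma continuous (hE : IsCondExp D E) : Continuous E := by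
  let _ := toCStarAlgebra A
  exact map_continuous (PositiveLinearMap.mk₀ E hE.pos)

lemma map_mul_left (hE : IsCondExp D E) {d : A} (hd : d ∈ D) (x : A) : E (d * x) = d * E x := by
  simpa using hE.bimod d hd 1 D.one_mem x

lemma map_mul_right (hE : IsCondExp D E) {d : A} (hd : d ∈ D) (x : A) : E (x * d) = E x * d := by
  simpa using hE.bimod 1 D.one_mem d hd x

/-- If `D` is a MASA, then `u E(u)* = E(u) E(u)*` for every normalizer `u`. -/
lemma mul_star_apply (hE : IsCondExp D E) (hm : IsMasa D) {u : A} (hu : u ∈ normSet D) :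
    u * star (E u) = E u * star (E u) := by
  have hD := hm.1
  have huu := normSet.mul_star_self_mem hu
  set b := star (E u) with hb
  have hbE : E (star u) = b := hE.map_star u
  have hbD : b ∈ D := star_mem (hE.mem u)
  have h1 : ∀ d ∈ D, star u * d * u * b = b * d * (u * star u) := fun d hd ↦ by
    rw [← hbE, ← hE.map_mul_left (hu.1 d hd), ← hE.map_mul_right hd, ← hE.map_mul_right huu]
    congr 1
    calc star u * d * u * star u = star u * (d * (u * star u)) := by simp only [mul_assoc]
      _ = _ := by simp only [mul_assoc]
  have h2 : star u * u * b = b * (u * star u) := by simpa using h1 1 D.one_mem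
  have hcomm : ∀ d ∈ D, u * b * d = d * (u * b) := by
    intro d hd
    have h3 : star u * (d * (u * b) - u * b * d) = 0 := by
      rw [mul_sub, sub_eq_zero]
      calc star u * (d * (u * b)) = star u * d * u * b := by simp only [mul_assoc]
        _ = b * (u * star u) * d := by rw [h1 d hd, mul_assoc, hD d hd _ huu, ← mul_assoc]
        _ = star u * (u * b * d) := by rw [← h2]; simp only [mul_assoc]
    generalize hX : d * (u * b) - u * b * d = X at h3
    have hsX : star X = star b * star u * star d - star d * (star b * star u) := by
      rw [← hX]
      simp only [star_sub, star_mul, mul_assoc]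
    have h4 : star X * X = 0 := by
      calc star X * X = star b * (star u * (star d * X)) - star d * star b * (star u * X) := by
            rw [hsX, sub_mul]
            simp only [mul_assoc]
        _ = 0 := by rw [star_mul_mul_eq_zero hD huu (star_mem hd) h3, h3]; simp
    rw [CStarRing.star_mul_self_eq_zero_iff] at h4
    exact (sub_eq_zero.1 (hX.trans h4)).symm
  rw [← hE.idOn _ (hm.2 _ hcomm), hE.map_mul_right hbD]

/-- The conditional expectation of a regular MASA inclusion is invariant under conjugation by
normalizers. -/
lemma apply_conj (hE : IsCondExp D E) (hr : IsRegularIncl D) (hm : IsMasa D) {v : A}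
    (hv : v ∈ normSet D) (x : A) : E (v * x * star v) = v * E x * star v := by
  have hD := hm.1
  have ht := normSet.mul_star_self_mem hv
  have hz := normSet.star_mul_self_mem hv
  let L : A →ₗ[ℂ] A := E ∘ₗ (LinearMap.mulRight ℂ (star v) ∘ₗ LinearMap.mulLeft ℂ v)
    - (LinearMap.mulRight ℂ (star v) ∘ₗ LinearMap.mulLeft ℂ v) ∘ₗ E
  have hL : ∀ y, L y = E (v * y * star v) - v * E y * star v := fun y ↦ rfl
  have hLc : Continuous L := by
    have := hE.continuous
    change Continuous fun y ↦ E (v * y * star v) - v * E y * star v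
    fun_prop
  suffices h : ∀ u ∈ normSet D, L u = 0 by
    have h1 : closure (Submodule.span ℂ (normSet D) : Set A) ⊆ LinearMap.ker L :=
      closure_minimal (Submodule.span_le.2 h) (isClosed_eq hLc continuous_const)
    rw [hr.2] at h1
    exact sub_eq_zero.1 (h1 (Set.mem_univ x))
  intro u hu
  have haD := hE.mem u
  have hq := normSet.mul_mem (normSet.mul_mem hv hu) (normSet.star_mem hv)
  have hcD := hE.mem (v * u * star v)
  have h1 := hE.mul_star_apply hm hu
  have h2 := hE.mul_star_apply hm hq
  rw [hL, sub_eq_zero]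
  set a := E u with ha
  set t := v * star v with htdef
  set z := star v * v with hzdef
  set q := v * u * star v with hqdef
  set c := E q with hc
  have hc'D := hv.2 a haD
  set c' := v * a * star v with hc'
  have h3 : c * star c' = c' * star c' := by
    have h4 : q * star c' = c' * star c' := by
      calc q * star c' = v * u * (z * star a) * star v := by
            simp only [hqdef, hc', hzdef, star_mul, star_star, mul_assoc]
        _ = v * (u * star a) * z * star v := by
            rw [hD _ hz _ (star_mem haD)]; simp only [mul_assoc]
        _ = v * a * (star a * z) * star v := by rw [h1]; simp only [mul_assoc]
        _ = c' * star c' := by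
            rw [hD _ (star_mem haD) _ hz]
            simp only [hc', hzdef, star_mul, star_star, mul_assoc]
    rw [hc, ← hE.map_mul_right (star_mem hc'D), h4, hE.idOn _ (mul_mem hc'D (star_mem hc'D))]
  have h5 : c * star q = c * star c := by
    simpa using congrArg star h2
  have h6 : star v * c * v * star a * z = star v * (c * star c) * v := by
    have h7 : star v * c * v * star u * z = star v * (c * star c) * v := by
      rw [← h5]
      simp only [hqdef, hzdef, star_mul, star_star, mul_assoc]
    have h8 := congrArg E h7
    rwa [hE.map_mul_right hz, hE.map_mul_left (hv.1 c hcD), hE.map_star, ← ha,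
      hE.idOn _ (hv.1 _ (mul_mem hcD (star_mem hcD)))] at h8
  set y := c * (star c' - star c) with hy
  have hsD : star c' - star c ∈ D := sub_mem (star_mem hc'D) (star_mem hcD)
  have hyD : y ∈ D := mul_mem hcD hsD
  have h9 : t * y * t = 0 := by
    have h10 : t * c * t * star c' = t * (c * star c) * t := by
      calc t * c * t * star c' = v * (star v * c * v * (z * star a)) * star v := by
            simp only [hc', htdef, hzdef, star_mul, star_star, mul_assoc]
        _ = v * (star v * c * v * star a * z) * star v := by
            rw [hD _ hz _ (star_mem haD)]; simp only [mul_assoc]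
        _ = t * (c * star c) * t := by rw [h6]; simp only [htdef, mul_assoc]
    calc t * y * t = t * c * (star c' * t) - t * (c * star c) * t := by
          simp only [hy, mul_sub, sub_mul, mul_assoc]
      _ = 0 := by rw [hD _ (star_mem hc'D) _ ht, ← mul_assoc, h10, sub_self]
  have h11 : y * t = 0 := by
    refine eq_zero_of_mul_self hD (mul_mem hyD ht) ?_
    rw [mul_assoc, ← mul_assoc t, h9, mul_zero]
  have h12 : y * v = 0 := by
    rw [← CStarRing.mul_star_self_eq_zero_iff, star_mul, ← mul_assoc, mul_assoc y, h11, zero_mul]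
  have h13 : y = 0 := by
    refine eq_zero_of_mul_self hD hyD ?_
    have h14 : y = E (q * (star c' - star c)) := by rw [hE.map_mul_right hsD]
    conv_lhs => rw [h14]
    rw [← h14]
    conv_lhs => arg 2; rw [h14]
    rw [← hE.map_mul_left hyD, hqdef, ← mul_assoc, ← mul_assoc, ← mul_assoc, h12]
    simp
  have h15 : c * star c' = c * star c := by
    rw [hy, mul_sub, sub_eq_zero] at h13
    exact h13
  have h16 : c' * star c = c * star c := by simpa using congrArg star h15
  have h17 : (c - c') * star (c - c') = 0 := by
    rw [star_sub, sub_mul, mul_sub, mul_sub, h16, ← h3, h15]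
    simp
  rw [CStarRing.mul_star_self_eq_zero_iff] at h17
  exact sub_eq_zero.1 h17

/-- In a Cartan inclusion, an essential subalgebra `D₀` of `D` has relative commutant `D`. -/
lemma mem_of_commute_essential (hE : IsCondExp D E) (hEf : Faithful E) (hr : IsRegularIncl D)
    (hm : IsMasa D) {D₀ : StarSubalgebra ℂ A} (hD₀D : D₀ ≤ D)
    (hess : EssentialInSet ↥D {x : ↥D | (x : A) ∈ D₀}) {x : A}
    (hx : ∀ h ∈ D₀, x * h = h * x) : x ∈ D := by
  have hD := hm.1
  set y := x - E x with hy
  have hyc : ∀ h ∈ D₀, y * h = h * y := fun h hh ↦ by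
    rw [hy, sub_mul, mul_sub, hx h hh, hD _ (hE.mem x) _ (hD₀D hh)]
  have hEy : E y = 0 := by rw [hy, map_sub, hE.idOn _ (hE.mem x), sub_self]
  have hv : ∀ v ∈ normSet D, E (star v * y) = 0 := by
    intro v hv
    have haD := hE.mem (star v * y)
    set a := E (star v * y) with ha
    have hw : v * a ∈ normSet D := normSet.mul_mem hv (normSet.of_mem haD)
    have ht := normSet.mul_star_self_mem hv
    have hz := normSet.star_mul_self_mem hv
    have hwc : ∀ h ∈ D₀, v * a * h = h * (v * a) := by
      intro h hh
      have hhD := hD₀D hh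
      have h1 : star v * (h * (v * a) - v * a * h) = 0 := by
        rw [mul_sub, sub_eq_zero]
        calc star v * (h * (v * a)) = star v * h * v * a := by simp only [mul_assoc]
          _ = E (star v * h * v * (star v * y)) := by rw [hE.map_mul_left (hv.1 h hhD)]
          _ = E (star v * v * (star v * y) * h) := by
              congr 1
              calc star v * h * v * (star v * y) = star v * (h * (v * star v)) * y := by
                    simp only [mul_assoc]
                _ = star v * (v * star v) * (h * y) := by
                    rw [hD _ hhD _ ht]; simp only [mul_assoc]
                _ = _ := by rw [← hyc h hh]; simp only [mul_assoc]
          _ = star v * (v * a * h) := by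
              rw [hE.map_mul_right hhD, hE.map_mul_left hz]; simp only [ha, mul_assoc]
      generalize hX : h * (v * a) - v * a * h = X at h1
      have hsX : star X = star a * star v * star h - star h * (star a * star v) := by
        rw [← hX]
        simp only [star_sub, star_mul, mul_assoc]
      have h4 : star X * X = 0 := by
        calc star X * X = star a * (star v * (star h * X)) - star h * star a * (star v * X) := by
              rw [hsX, sub_mul]
              simp only [mul_assoc]
          _ = 0 := by rw [star_mul_mul_eq_zero hD ht (star_mem hhD) h1, h1]; simp
      rw [CStarRing.star_mul_self_eq_zero_iff] at h4
      exact (sub_eq_zero.1 (hX.trans h4)).symm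
    have hwD : v * a ∈ D := hm.2 _ (commute_of_commute_essential hD hr.1.2 hess hw hwc)
    rw [← CStarRing.star_mul_self_eq_zero_iff, ha, ← hE.map_mul_left (star_mem haD), ← mul_assoc,
      ← star_mul, hE.map_mul_left (star_mem hwD), hEy, mul_zero]
  let L : A →ₗ[ℂ] A := E ∘ₗ LinearMap.mulRight ℂ y
  have hL : closure (Submodule.span ℂ (normSet D) : Set A) ⊆ LinearMap.ker L := by
    refine closure_minimal (Submodule.span_le.2 fun v hv' ↦ ?_)
      (isClosed_eq (hE.continuous.comp (continuous_mul_const y)) continuous_const)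
    have := hv _ (normSet.star_mem hv')
    rw [star_star] at this
    exact this
  rw [hr.2] at hL
  have h0 : y = 0 := hEf y (hL (Set.mem_univ (star y)))
  rw [sub_eq_zero.1 h0]
  exact hE.mem x

lemma topologicalClosure_adjoin_le (hE : IsCondExp D E) (hcl : IsClosed (D : Set A)) (S : Set A) :
    (StarAlgebra.adjoin ℂ (E '' S)).topologicalClosure ≤ D :=
  StarSubalgebra.topologicalClosure_minimal
    (StarAlgebra.adjoin_le (Set.image_subset_iff.2 fun x _ ↦ hE.mem x)) hcl

/-- In a Cartan inclusion, every normalizer of an essential subalgebra of `D` normalizes `D`. -/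
lemma normSet_subset_of_essential (hE : IsCondExp D E) (hEf : Faithful E) (hr : IsRegularIncl D)
    (hm : IsMasa D) {D₀ : StarSubalgebra ℂ A} (hD₀D : D₀ ≤ D)
    (hess : EssentialInSet ↥D {x : ↥D | (x : A) ∈ D₀}) : normSet D₀ ⊆ normSet D := by
  intro v hv
  refine ⟨fun d hd ↦ ?_, fun d hd ↦ ?_⟩
  · exact hE.mem_of_commute_essential hEf hr hm hD₀D hess fun h hh ↦
      conj_commute hm.1 hD₀D hv hd hh
  · refine hE.mem_of_commute_essential hEf hr hm hD₀D hess fun h hh ↦ ?_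
    simpa using conj_commute hm.1 hD₀D (normSet.star_mem hv) hd hh

/-- Conjugation by a normalizer `v ∈ C₀` of `D` leaves the `C*`-algebra generated by `E(C₀)`
invariant, provided that algebra contains `v v*`. -/
lemma conj_mem_topologicalClosure_adjoin (hE : IsCondExp D E) (hr : IsRegularIncl D)
    (hm : IsMasa D) {C₀ : StarSubalgebra ℂ A} {v : A} (hv : v ∈ normSet D) (hvC : v ∈ C₀)
    (hvv : v * star v ∈ (StarAlgebra.adjoin ℂ (E '' (C₀ : Set A))).topologicalClosure)
    {d : A} (hd : d ∈ (StarAlgebra.adjoin ℂ (E '' (C₀ : Set A))).topologicalClosure) :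
    v * d * star v ∈ (StarAlgebra.adjoin ℂ (E '' (C₀ : Set A))).topologicalClosure := by
  have hD₁D := hE.topologicalClosure_adjoin_le hr.1.2 C₀
  have hle := StarSubalgebra.le_topologicalClosure (StarAlgebra.adjoin ℂ (E '' (C₀ : Set A)))
  have hcl := StarSubalgebra.isClosed_topologicalClosure
    (StarAlgebra.adjoin ℂ (E '' (C₀ : Set A)))
  set D₁ := (StarAlgebra.adjoin ℂ (E '' (C₀ : Set A))).topologicalClosure with hD₁
  have hadj : ∀ x ∈ StarAlgebra.adjoin ℂ (E '' (C₀ : Set A)), v * x * star v ∈ D₁ := by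
    intro x hx
    induction hx using StarAlgebra.adjoin_induction with
    | mem x hx =>
      obtain ⟨y, hy, rfl⟩ := hx
      rw [← hE.apply_conj hr hm hv]
      exact hle (StarAlgebra.subset_adjoin ℂ _
        ⟨_, mul_mem (mul_mem hvC hy) (star_mem hvC), rfl⟩)
    | algebraMap r =>
      rw [← Algebra.commutes, mul_assoc]
      exact mul_mem (D₁.algebraMap_mem r) hvv
    | add x y _ _ hx hy =>
      rw [mul_add, add_mul]
      exact add_mem hx hy
    | mul x y hxm _ hx hy =>
      obtain ⟨c, hc, hlim⟩ := exists_tendsto_mul_self hvv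
      have hmem : v * (x * y * star v) ∈ D₁ := by
        refine hcl.mem_of_tendsto (hlim.mul_const (x * y * star v)) (.of_forall fun n ↦ ?_)
        have h1 : c n * (v * star v) * v * (x * y * star v)
            = c n * ((v * x * star v) * (v * y * star v)) := by
          calc c n * (v * star v) * v * (x * y * star v)
              = c n * v * (star v * v * x) * y * star v := by simp only [mul_assoc]
            _ = _ := by
              rw [hm.1 _ (normSet.star_mul_self_mem hv) _ (hD₁D (hle hxm))]
              simp only [mul_assoc]
        rw [h1]
        exact mul_mem (hc n) (mul_mem hx hy)
      rwa [mul_assoc]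
    | star x _ hx =>
      have := star_mem hx
      rwa [star_mul, star_mul, star_star, ← mul_assoc] at this
  have hsub : closure (StarAlgebra.adjoin ℂ (E '' (C₀ : Set A)) : Set A) ⊆
      {x | v * x * star v ∈ D₁} :=
    closure_minimal hadj (hcl.preimage (by fun_prop : Continuous fun x ↦ v * x * star v))
  exact hsub hd

end IsCondExp

/-- The relative normalizers span the `*`-algebra they generate. -/
lemma closure_span_normSetRel (C D : StarSubalgebra ℂ A) :
    ((StarAlgebra.adjoin ℂ (normSetRel C D)).topologicalClosure : Set A) =
      closure (Submodule.span ℂ (normSetRel C D) : Set A) := by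
  let N : Submonoid A :=
    { carrier := normSetRel C D
      mul_mem' := fun ⟨hv, hv1, hv2⟩ ⟨hw, hw1, hw2⟩ ↦
        ⟨mul_mem hv hw, normSet.mul_mem (D := D) ⟨hv1, hv2⟩ ⟨hw1, hw2⟩⟩
      one_mem' := ⟨C.one_mem, normSet.of_mem D.one_mem⟩ }
  have hN : Submonoid.closure (normSetRel C D ∪ star (normSetRel C D)) = N := by
    refine le_antisymm (Submonoid.closure_le.2 (Set.union_subset subset_rfl fun v hv ↦ ?_))
      fun v hv ↦ Submonoid.subset_closure (Or.inl hv)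
    obtain ⟨h, h1, h2⟩ := hv
    have h3 := normSet.star_mem (D := D) ⟨h1, h2⟩
    rw [star_star] at h3
    exact ⟨by simpa using star_mem h, h3⟩
  have h := StarAlgebra.adjoin_eq_span (R := ℂ) (normSetRel C D)
  rw [hN] at h
  rw [StarSubalgebra.topologicalClosure_coe]
  exact congrArg closure (congrArg (SetLike.coe : Submodule ℂ A → Set A) h)

/-- If `M` spans a dense subspace of `C₀` and consists of normalizers of `D₁`, the products
`x * d` with `x ∈ C₀` and `d ∈ D₁` span a dense subspace of `C*(C₀ ∪ D₁)`. -/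
lemma topologicalClosure_adjoin_union_subset {C₀ D₁ : StarSubalgebra ℂ A} (hD₁ : IsAbelian D₁)
    {M : Set A} (hM : M ⊆ normSet D₁)
    (hC₀ : (C₀ : Set A) = closure (Submodule.span ℂ M : Set A)) :
    ((StarAlgebra.adjoin ℂ ((C₀ : Set A) ∪ D₁)).topologicalClosure : Set A) ⊆
      closure (Submodule.span ℂ (Set.image2 (· * ·) (C₀ : Set A) D₁) : Set A) := by
  have hMC : M ⊆ C₀ := by
    rw [hC₀]
    exact Submodule.subset_span.trans subset_closure
  let K := (Submodule.span ℂ (Set.image2 (· * ·) (C₀ : Set A) D₁)).topologicalClosure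
  have hK : IsClosed (K : Set A) := Submodule.isClosed_topologicalClosure _
  have hmem : ∀ x ∈ C₀, ∀ d ∈ D₁, x * d ∈ K := fun x hx d hd ↦
    subset_closure (Submodule.subset_span ⟨x, hx, d, hd, rfl⟩)
  have hind : ∀ S : Submodule ℂ A, IsClosed (S : Set A) → (∀ x ∈ C₀, ∀ d ∈ D₁, x * d ∈ S) →
      K ≤ S := fun S hS h ↦ Submodule.topologicalClosure_minimal _
        (Submodule.span_le.2 (Set.image2_subset_iff.2 h)) hS
  have hleft : ∀ y : A, IsClosed (K.comap (LinearMap.mulLeft ℂ y) : Set A) := fun y ↦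
    hK.preimage (continuous_const_mul y)
  have hDM : ∀ y ∈ D₁, ∀ x ∈ M, y * x ∈ K := by
    intro y hy x hx
    have hxx := normSet.mul_star_self_mem (hM hx)
    obtain ⟨c, hc, hlim⟩ := exists_tendsto_mul_self hxx
    refine hK.mem_of_tendsto (hlim.const_mul y) (.of_forall fun n ↦ ?_)
    have hyc := mul_mem hy (hc n)
    have h1 : y * (c n * (x * star x) * x) = x * (star x * (y * c n) * x) := by
      calc y * (c n * (x * star x) * x) = (y * c n) * (x * star x) * x := by
            simp only [mul_assoc]
        _ = _ := by rw [hD₁ _ hyc _ hxx]; simp only [mul_assoc]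
    rw [h1]
    exact hmem _ (hMC hx) _ ((hM hx).1 _ hyc)
  have hDC : ∀ y ∈ D₁, ∀ x ∈ C₀, y * x ∈ K := by
    intro y hy x hx
    have h1 : (Submodule.span ℂ M).topologicalClosure ≤ K.comap (LinearMap.mulLeft ℂ y) :=
      Submodule.topologicalClosure_minimal _ (Submodule.span_le.2 (hDM y hy)) (hleft y)
    exact h1 (hC₀ ▸ hx : x ∈ closure (Submodule.span ℂ M : Set A))
  have hCK : ∀ y ∈ C₀, ∀ k ∈ K, y * k ∈ K := fun y hy ↦
    hind (K.comap (LinearMap.mulLeft ℂ y)) (hleft y) fun x hx d hd ↦ by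
      simpa [mul_assoc] using hmem _ (mul_mem hy hx) d hd
  have hKD : ∀ d ∈ D₁, ∀ k ∈ K, k * d ∈ K := fun d hd ↦
    hind (K.comap (LinearMap.mulRight ℂ d)) (hK.preimage (continuous_mul_const d))
      fun x hx e he ↦ by simpa [mul_assoc] using hmem x hx _ (mul_mem he hd)
  have hDK : ∀ y ∈ D₁, ∀ k ∈ K, y * k ∈ K := fun y hy ↦
    hind (K.comap (LinearMap.mulLeft ℂ y)) (hleft y) fun x hx d hd ↦ by
      simpa [mul_assoc] using hKD d hd _ (hDC y hy x hx)
  have hadj : ∀ y ∈ StarAlgebra.adjoin ℂ ((C₀ : Set A) ∪ D₁),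
      (∀ k ∈ K, y * k ∈ K) ∧ ∀ k ∈ K, star y * k ∈ K := by
    intro y hy
    induction hy using StarAlgebra.adjoin_induction with
    | mem y hy =>
      rcases hy with hy | hy
      · exact ⟨hCK y hy, hCK _ (star_mem hy)⟩
      · exact ⟨hDK y hy, hDK _ (star_mem hy)⟩
    | algebraMap r =>
      refine ⟨fun k hk ↦ ?_, fun k hk ↦ ?_⟩
      · simpa [Algebra.algebraMap_eq_smul_one] using K.smul_mem r hk
      · simpa [Algebra.algebraMap_eq_smul_one] using K.smul_mem (star r) hk
    | add x y _ _ hx hy =>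
      refine ⟨fun k hk ↦ ?_, fun k hk ↦ ?_⟩
      · rw [add_mul]
        exact K.add_mem (hx.1 k hk) (hy.1 k hk)
      · rw [star_add, add_mul]
        exact K.add_mem (hx.2 k hk) (hy.2 k hk)
    | mul x y _ _ hx hy =>
      refine ⟨fun k hk ↦ ?_, fun k hk ↦ ?_⟩
      · rw [mul_assoc]
        exact hx.1 _ (hy.1 k hk)
      · rw [star_mul, mul_assoc]
        exact hy.2 _ (hx.2 k hk)
    | star x _ hx => exact ⟨hx.2, by simpa using hx.1⟩
  have hone : (1 : A) ∈ K := by simpa using hmem 1 C₀.one_mem 1 D₁.one_mem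
  exact closure_minimal (fun y hy ↦ mul_one y ▸ (hadj y hy).1 1 hone) hK

/-- Let `(A,D)` be a Cartan inclusion with faithful conditional expectation
`E`, let `D₀ ⊆ D` with `(D,D₀)` essential, and let `M ⊆ N(A,D₀)` be a `*`-monoid whose
closed linear span `C₀` contains `D₀`.  With `D₁ = C*(E(C₀))` and `C₁ = C*(C₀ ∪ D₁)` and
`α` the inclusion, `(C₀,D₀)` is a regular inclusion and `(C₁,D₁,α)` is its Cartan
envelope. -/
theorem stmt14 (D : StarSubalgebra ℂ A)
    (hcar : IsRegularIncl D ∧ IsMasa D)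
    (E : A →ₗ[ℂ] A) (hE : IsCondExp D E) (hEf : Faithful E)
    (D₀ : StarSubalgebra ℂ A) (hD₀D : D₀ ≤ D) (hD₀cl : IsClosed (D₀ : Set A))
    (hess : EssentialInSet ↥D {x : ↥D | (x : A) ∈ D₀})
    (M : Set A) (hM : M ⊆ normSet D₀)
    (hMone : (1 : A) ∈ M) (hMmul : ∀ x ∈ M, ∀ y ∈ M, x * y ∈ M)
    (hMstar : ∀ x ∈ M, star x ∈ M)
    (C₀ : StarSubalgebra ℂ A) (hC₀ : (C₀ : Set A) = closure (Submodule.span ℂ M : Set A))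
    (hD₀C₀ : (D₀ : Set A) ⊆ (C₀ : Set A)) :
    -- (C₀, D₀) is a regular inclusion:
    (D₀ ≤ C₀ ∧ IsAbelian D₀ ∧
      (C₀ : Set A) ⊆ closure (Submodule.span ℂ (normSetRel C₀ D₀) : Set A)) ∧
    -- (C₁, D₁, inclusion) is a Cartan envelope for (C₀, D₀), where
    -- D₁ = C*(E(C₀)) and C₁ = C*(C₀ ∪ D₁):
    (let D₁ : StarSubalgebra ℂ A :=
        (StarAlgebra.adjoin ℂ (⇑E '' (C₀ : Set A))).topologicalClosure
     let C₁ : StarSubalgebra ℂ A :=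
        (StarAlgebra.adjoin ℂ ((C₀ : Set A) ∪ (D₁ : Set A))).topologicalClosure
     D₁ ≤ C₁ ∧ IsAbelian D₁ ∧
     (C₁ : Set A) ⊆ closure (Submodule.span ℂ (normSetRel C₁ D₁) : Set A) ∧
     (∀ x ∈ C₁, (∀ d ∈ D₁, x * d = d * x) → x ∈ D₁) ∧
     (∀ x ∈ C₁, E x ∈ D₁) ∧ (∀ d ∈ D₁, E d = d) ∧
     (∀ x ∈ C₁, E (star x * x) = 0 → x = 0) ∧
     (C₀ ≤ C₁) ∧ (normSetRel C₀ D₀ ⊆ normSetRel C₁ D₁) ∧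
     EssentialInSet ↥D₁ {x : ↥D₁ | (x : A) ∈ D₀}) := by
  have hD := hcar.2.1
  have hcl := hcar.1.1.2
  have hMC : M ⊆ C₀ := by
    rw [hC₀]
    exact Submodule.subset_span.trans subset_closure
  have hND := hE.normSet_subset_of_essential hEf hcar.1 hcar.2 hD₀D hess
  have hD₀C : D₀ ≤ C₀ := hD₀C₀
  refine ⟨⟨hD₀C, fun x hx y hy ↦ hD x (hD₀D hx) y (hD₀D hy), ?_⟩, ?_⟩
  · rw [hC₀]
    exact closure_mono (Submodule.span_mono fun v hv ↦ ⟨hMC hv, hM hv⟩)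
  intro D₁ C₁
  have hD₁D : D₁ ≤ D := hE.topologicalClosure_adjoin_le hcl C₀
  have hED₁ : ∀ x ∈ C₀, E x ∈ D₁ := fun x hx ↦
    StarSubalgebra.le_topologicalClosure _ (StarAlgebra.subset_adjoin ℂ _ ⟨x, hx, rfl⟩)
  have hD₀D₁ : D₀ ≤ D₁ := fun d hd ↦ hE.idOn d (hD₀D hd) ▸ hED₁ d (hD₀C hd)
  have hgen : (C₀ : Set A) ∪ D₁ ⊆ C₁ := fun x hx ↦
    StarSubalgebra.le_topologicalClosure _ (StarAlgebra.subset_adjoin ℂ _ hx)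
  have hC₀C₁ : C₀ ≤ C₁ := fun x hx ↦ hgen (Or.inl hx)
  have hD₁C₁ : D₁ ≤ C₁ := fun x hx ↦ hgen (Or.inr hx)
  have hD₁ab : IsAbelian D₁ := fun x hx y hy ↦ hD x (hD₁D hx) y (hD₁D hy)
  have hN : ∀ v ∈ C₀, v ∈ normSet D₀ → v ∈ normSet D₁ := by
    have hconj : ∀ v ∈ C₀, v ∈ normSet D₀ → ∀ d ∈ D₁, v * d * star v ∈ D₁ := fun v hvC hv d hd ↦
      hE.conj_mem_topologicalClosure_adjoin hcar.1 hcar.2 (hND hv) hvC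
        (hD₀D₁ (normSet.mul_star_self_mem hv)) hd
    refine fun v hvC hv ↦ ⟨fun d hd ↦ ?_, hconj v hvC hv⟩
    simpa using hconj _ (star_mem hvC) (normSet.star_mem hv) d hd
  have hrel : normSetRel C₀ D₀ ⊆ normSetRel C₁ D₁ := fun v hv ↦
    ⟨hC₀C₁ hv.1, hN v hv.1 hv.2⟩
  have hEC₁ : ∀ x ∈ C₁, E x ∈ D₁ := by
    have h1 : closure (Submodule.span ℂ (Set.image2 (· * ·) (C₀ : Set A) D₁) : Set A) ⊆
        (D₁.toSubalgebra.toSubmodule.comap E : Set A) := by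
      refine closure_minimal (Submodule.span_le.2 (Set.image2_subset_iff.2 fun x hx d hd ↦ ?_))
        ((StarSubalgebra.isClosed_topologicalClosure _).preimage hE.continuous)
      change E (x * d) ∈ D₁
      rw [hE.map_mul_right (hD₁D hd)]
      exact mul_mem (hED₁ x hx) hd
    exact fun x hx ↦ h1 (topologicalClosure_adjoin_union_subset hD₁ab
      (fun v hv ↦ hN v (hMC hv) (hM hv)) hC₀ hx)
  refine ⟨hD₁C₁, hD₁ab, ?_, ?_, hEC₁, fun d hd ↦ hE.idOn d (hD₁D hd), fun x _ ↦ hEf x, hC₀C₁, hrel,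
    EssentialInSet.of_le hD hD₀D₁ hD₁D hess⟩
  · rw [← closure_span_normSetRel]
    refine StarSubalgebra.topologicalClosure_minimal (StarAlgebra.adjoin_le ?_)
      (StarSubalgebra.isClosed_topologicalClosure _)
    refine Set.union_subset ?_ fun d hd ↦ StarSubalgebra.le_topologicalClosure _
      (StarAlgebra.subset_adjoin ℂ _ ⟨hD₁C₁ hd, normSet.of_mem hd⟩)
    rw [closure_span_normSetRel, hC₀]
    exact closure_mono (Submodule.span_mono fun v hv ↦ hrel ⟨hMC hv, hM hv⟩)
  · intro x hx hxc
    have hxD := hE.mem_of_commute_essential hEf hcar.1 hcar.2 hD₀D hess fun h hh ↦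
      hxc h (hD₀D₁ hh)
    exact hE.idOn x hxD ▸ hEC₁ x hx

end RegularInclusion
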